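/- arXiv:2506.09285 — 2 statements merged into one kernel-verified Lean document; each statement's English description precedes it below -/
import Mathlib

section
/- Let p, q ∈ A_1(K) satisfy q·p = p·q + 1, and suppose there exist polynomials B, D ∈ K[X] and elements U, V ∈ A_1(K) such that p = B(t)·t + U·x, q = D(t)·t + V·x, and the 2 × 2 matrix with rows (B(t), U) and (D(t), V) is an invertible element of the matrix ring M_2(A_1(K)). Then there exists a K-algebra endomorphism α of A_1(K) with α(t) = p and α(x) = q, and every such α is bijective. -/
/-- The defining relation of the first Weyl algebra `A₁(K)`: `x·t = t·x + 1`, where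
`t` is the image of the generator `0` and `x` is the image of the generator `1`. -/
def weylRel (K : Type*) [Field K] :
    FreeAlgebra K (Fin 2) → FreeAlgebra K (Fin 2) → Prop := fun a b =>
  a = FreeAlgebra.ι K (1 : Fin 2) * FreeAlgebra.ι K (0 : Fin 2) ∧
  b = FreeAlgebra.ι K (0 : Fin 2) * FreeAlgebra.ι K (1 : Fin 2) + 1

/-- The first Weyl algebra `A₁(K)`: the quotient of the free algebra on two generators
`t, x` by the two-sided ideal generated by `x·t − t·x − 1`. -/
abbrev Weyl (K : Type*) [Field K] : Type _ := RingQuot (weylRel K)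

/-- The generator `t` of the first Weyl algebra. -/
noncomputable def wT (K : Type*) [Field K] : Weyl K :=
  RingQuot.mkAlgHom K (weylRel K) (FreeAlgebra.ι K (0 : Fin 2))

/-- The generator `x` of the first Weyl algebra. -/
noncomputable def wX (K : Type*) [Field K] : Weyl K :=
  RingQuot.mkAlgHom K (weylRel K) (FreeAlgebra.ι K (1 : Fin 2))


namespace WeylAux
open Polynomial

variable {K : Type*} [Field K]

lemma xt : wX K * wT K = wT K * wX K + 1 := by
  have := RingQuot.mkAlgHom_rel K (s := weylRel K) (x := FreeAlgebra.ι K (1 : Fin 2) * FreeAlgebra.ι K (0 : Fin 2)) (y := FreeAlgebra.ι K (0 : Fin 2) * FreeAlgebra.ι K (1 : Fin 2) + 1) ⟨rfl, rfl⟩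
  simpa [wX, wT] using this

/-- lifting -/
lemma exists_lift {A : Type*} [Semiring A] [Algebra K A] (p q : A) (h : q * p = p * q + 1) :
    ∃ α : Weyl K →ₐ[K] A, α (wT K) = p ∧ α (wX K) = q := by
  refine ⟨RingQuot.liftAlgHom K ⟨FreeAlgebra.lift K ![p, q], ?_⟩, ?_, ?_⟩
  · rintro a b ⟨rfl, rfl⟩
    simpa using h
  · simp [wT]
  · simp [wX]

lemma weyl_induction {P : Weyl K → Prop} (hc : ∀ c, P (algebraMap K _ c)) (ht : P (wT K))
    (hx : P (wX K)) (ha : ∀ a b, P a → P b → P (a + b)) (hm : ∀ a b, P a → P b → P (a * b))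
    (a : Weyl K) : P a := by
  obtain ⟨b, rfl⟩ := RingQuot.mkAlgHom_surjective K (weylRel K) a
  induction b using FreeAlgebra.induction with
  | grade0 r => simpa using hc r
  | grade1 i => fin_cases i
                · exact ht
                · exact hx
  | mul a b h1 h2 => rw [map_mul]; exact hm _ _ h1 h2
  | add a b h1 h2 => rw [map_add]; exact ha _ _ h1 h2

/-- derivative in the coefficients -/
noncomputable def dt : K[X][X] →ₗ[K] K[X][X] where
  toFun f := PolynomialModule.equivPolynomialSelf
    ((Polynomial.derivative' : Derivation K K[X] K[X]).mapCoeffs f)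
  map_add' f g := by simp
  map_smul' c f := by
    rw [Derivation.map_smul]
    ext1 n
    simp [PolynomialModule.equivPolynomialSelf]

lemma dt_coeff (f : K[X][X]) (n : ℕ) : (dt f).coeff n = derivative (f.coeff n) := by
  change _ = (Polynomial.derivative' : Derivation K K[X] K[X]) (f.coeff n)
  rw [← Derivation.mapCoeffs_apply]
  rfl

/-- action of x -/
noncomputable def T : K[X][X] →ₗ[K] K[X][X] := LinearMap.mulLeft K X + dt

lemma T_apply (f : K[X][X]) : T f = X * f + dt f := rfl

lemma dt_CX_mul (f : K[X][X]) : dt (C X * f) = C X * dt f + f := by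
  ext1 n
  simp [dt_coeff, add_comm]

lemma exists_rho : ∃ α : Weyl K →ₐ[K] Module.End K K[X][X],
    α (wT K) = LinearMap.mulLeft K (C X) ∧ α (wX K) = T := by
  apply exists_lift
  apply LinearMap.ext
  intro f
  simp only [Module.End.mul_apply, LinearMap.add_apply, Module.End.one_apply, T_apply,
    LinearMap.mulLeft_apply, dt_CX_mul]
  ring

noncomputable def rho : Weyl K →ₐ[K] Module.End K K[X][X] := exists_rho.choose
lemma rho_t : rho (wT K) = LinearMap.mulLeft K (C X) := exists_rho.choose_spec.1
lemma rho_x : rho (wX K) = T := exists_rho.choose_spec.2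

noncomputable def sg : Weyl K →ₗ[K] K[X][X] := (LinearMap.applyₗ 1) ∘ₗ rho.toLinearMap

lemma sg_apply (a : Weyl K) : sg a = rho a 1 := rfl

lemma sg_mul (a b : Weyl K) : sg (a * b) = rho a (sg b) := by simp [sg_apply]

lemma rho_aeval (f : K[X]) (g : K[X][X]) : rho (aeval (wT K) f) g = C f * g := by
  induction f using Polynomial.induction_on' generalizing g with
  | add p q h1 h2 => simp [h1, h2, add_mul]
  | monomial n a =>
    rw [aeval_monomial, map_mul, map_pow, rho_t, LinearMap.pow_mulLeft, ← C_mul_X_pow_eq_monomial]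
    simp [Module.End.mul_apply, Algebra.smul_def, mul_assoc]

/-- normal ordering -/
noncomputable def Ph (f : K[X][X]) : Weyl K := eval₂ (aeval (wT K) : K[X] →ₐ[K] Weyl K).toRingHom (wX K) f

lemma Ph_add (f g : K[X][X]) : Ph (f + g) = Ph f + Ph g := eval₂_add _ _
lemma Ph_mon (n : ℕ) (g : K[X]) : Ph (monomial n g) = aeval (wT K) g * wX K ^ n := by
  simp [Ph, eval₂_monomial]
lemma Ph_C (g : K[X]) : Ph (C g) = aeval (wT K) g := by simp [Ph]
lemma Ph_mul_X (f : K[X][X]) : Ph (f * X) = Ph f * wX K := by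
  simp [Ph, eval₂_mul_X]

lemma x_aeval (f : K[X]) : wX K * aeval (wT K) f = aeval (wT K) f * wX K + aeval (wT K) (derivative f) := by
  induction f using Polynomial.induction_on with
  | C a => simp [Algebra.commutes]
  | add p q h1 h2 => simp only [map_add, mul_add, add_mul, h1, h2]; abel
  | monomial n a h =>
    rw [pow_succ, ← mul_assoc, derivative_mul, derivative_X, map_mul, ← mul_assoc, h]
    simp only [map_add, map_mul, aeval_X, add_mul, mul_assoc, xt, mul_add, mul_one]
    abel

lemma Ph_zero : Ph (0 : K[X][X]) = 0 := by simp [Ph]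

lemma dt_mon (n : ℕ) (g : K[X]) : dt (monomial n g) = monomial n (derivative g) := by
  ext1 m
  rw [dt_coeff, coeff_monomial, coeff_monomial]
  split_ifs <;> simp

lemma mul_Ph (a : Weyl K) : ∀ f, a * Ph f = Ph (rho a f) := by
  induction a using weyl_induction with
  | hc c =>
    intro f
    rw [← aeval_C (wT K), rho_aeval]
    induction f using Polynomial.induction_on' with
    | add p q h1 h2 => rw [mul_add, Ph_add, Ph_add, mul_add, h1, h2]
    | monomial n a => rw [C_mul_monomial, Ph_mon, Ph_mon, map_mul, mul_assoc]
  | ht =>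
    intro f
    rw [rho_t, LinearMap.mulLeft_apply]
    induction f using Polynomial.induction_on' with
    | add p q h1 h2 => rw [mul_add, Ph_add, Ph_add, mul_add, h1, h2]
    | monomial n a => rw [C_mul_monomial, Ph_mon, Ph_mon, map_mul, mul_assoc, aeval_X]
  | hx =>
    intro f
    rw [rho_x]
    induction f using Polynomial.induction_on' with
    | add p q h1 h2 => rw [map_add, Ph_add, Ph_add, mul_add, h1, h2]
    | monomial n a =>
      rw [T_apply, dt_mon, X_mul_monomial, Ph_add, Ph_mon, Ph_mon, Ph_mon, ← mul_assoc, x_aeval, add_mul,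
        pow_succ', mul_assoc]
  | ha a b h1 h2 => intro f; rw [add_mul, h1, h2, map_add, LinearMap.add_apply, Ph_add]
  | hm a b h1 h2 => intro f; rw [mul_assoc, h2, h1, map_mul, Module.End.mul_apply]

lemma Ph_sg (a : Weyl K) : Ph (sg a) = a := by
  rw [sg_apply, ← mul_Ph, ← C_1, Ph_C]; simp

lemma sg_aeval_mul (f : K[X]) (b : Weyl K) : sg (aeval (wT K) f * b) = C f * sg b := by
  rw [sg_mul, rho_aeval]

lemma sg_one : sg (1 : Weyl K) = 1 := by simp [sg_apply]

lemma sg_aeval (f : K[X]) : sg (aeval (wT K) f) = C f := by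
  rw [← mul_one (aeval (wT K) f), sg_aeval_mul, sg_one, mul_one]

lemma sg_x_mul (b : Weyl K) : sg (wX K * b) = X * sg b + dt (sg b) := by
  rw [sg_mul, rho_x, T_apply]

lemma sg_x_pow (n : ℕ) : sg (wX K ^ n) = X ^ n := by
  induction n with
  | zero => simp [sg_one]
  | succ n ih =>
    rw [pow_succ', sg_x_mul, ih, pow_succ']
    rw [X_pow_eq_monomial, dt_mon]; simp

lemma sg_Ph (f : K[X][X]) : sg (Ph f) = f := by
  induction f using Polynomial.induction_on' with
  | add p q h1 h2 => rw [Ph_add, map_add, h1, h2]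
  | monomial n a => rw [Ph_mon, sg_aeval_mul, sg_x_pow, C_mul_X_pow_eq_monomial]

lemma sg_inj {a b : Weyl K} (h : sg a = sg b) : a = b := by rw [← Ph_sg a, h, Ph_sg]

lemma sg_mul_x (a : Weyl K) : sg (a * wX K) = sg a * X := by
  conv_lhs => rw [← Ph_sg a, ← Ph_mul_X, sg_Ph]

lemma x_pow_t (n : ℕ) : wX K ^ n * wT K = wT K * wX K ^ n + (n : Weyl K) * wX K ^ (n - 1) := by
  induction n with
  | zero => simp
  | succ n ih =>
    rw [pow_succ', mul_assoc, ih, mul_add, ← mul_assoc, xt, ← mul_assoc, ← Nat.cast_comm, mul_assoc, ← pow_succ']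
    rcases n with _ | n
    · simp
    · simp [add_mul, mul_assoc]; abel

lemma sg_mul_t (a : Weyl K) : sg (a * wT K) = C X * sg a + derivative (sg a) := by
  obtain ⟨f, rfl⟩ : ∃ f, a = Ph f := ⟨_, (Ph_sg a).symm⟩
  rw [sg_Ph]
  induction f using Polynomial.induction_on' with
  | add p q h1 h2 => rw [Ph_add, add_mul, map_add, h1, h2, map_add]; ring
  | monomial n a =>
    have : (n : Weyl K) = aeval (wT K) (n : K[X]) := by simp
    rw [Ph_mon, mul_assoc, x_pow_t, sg_aeval_mul, map_add, this, sg_aeval_mul]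
    have h2 : sg (wT K * wX K ^ n) = C X * X ^ n := by
      rw [sg_mul, rho_t, LinearMap.mulLeft_apply, sg_x_pow]
    rw [h2, sg_x_pow, derivative_monomial, ← C_mul_X_pow_eq_monomial, ← C_mul_X_pow_eq_monomial]
    simp
    ring

lemma sg_t_mul (a : Weyl K) : sg (wT K * a) = C X * sg a := by
  rw [sg_mul, rho_t, LinearMap.mulLeft_apply]

/-! coefficients -/

lemma T_coeff_succ (f : K[X][X]) (k : ℕ) : (T f).coeff (k+1) = f.coeff k + derivative (f.coeff (k+1)) := by
  rw [T_apply, coeff_add, coeff_X_mul, dt_coeff]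

lemma T_coeff_zero (f : K[X][X]) : (T f).coeff 0 = derivative (f.coeff 0) := by
  rw [T_apply, coeff_add, coeff_X_mul_zero, dt_coeff, zero_add]

lemma T_natDegree (f : K[X][X]) (n : ℕ) (h : f.natDegree ≤ n) (i : ℕ) :
    ((T ^ i : Module.End K K[X][X]) f).natDegree ≤ n + i := by
  induction i with
  | zero => simpa
  | succ i ih =>
    rw [pow_succ', Module.End.mul_apply, natDegree_le_iff_coeff_eq_zero]
    intro k hk
    obtain ⟨k, rfl⟩ : ∃ j, k = j + 1 := ⟨k - 1, by omega⟩
    rw [T_coeff_succ, coeff_eq_zero_of_natDegree_lt (by omega), coeff_eq_zero_of_natDegree_lt (by omega)]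
    simp

lemma T_top (f : K[X][X]) (n : ℕ) (h : f.natDegree ≤ n) (i : ℕ) :
    ((T ^ i : Module.End K K[X][X]) f).coeff (n + i) = f.coeff n := by
  induction i with
  | zero => simp
  | succ i ih =>
    have := T_natDegree f n h i
    rw [pow_succ', Module.End.mul_apply, ← add_assoc, T_coeff_succ, ih,
      coeff_eq_zero_of_natDegree_lt (n := n + i + 1) (by omega)]
    simp

lemma T_sub (f : K[X][X]) (n : ℕ) (h : f.natDegree ≤ n + 1) (i : ℕ) :
    ((T ^ i : Module.End K K[X][X]) f).coeff (n + i) = f.coeff n + i * derivative (f.coeff (n + 1)) := by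
  induction i with
  | zero => simp
  | succ i ih =>
    have := T_top f (n+1) h i
    rw [show n + 1 + i = n + i + 1 by ring] at this
    rw [pow_succ', Module.End.mul_apply, ← add_assoc, T_coeff_succ, ih, this]
    push_cast; ring

lemma sg_mul_sum (a b : Weyl K) (N : ℕ) (h : (sg a).natDegree < N) :
    sg (a * b) = ∑ i ∈ Finset.range N, C ((sg a).coeff i) * (T ^ i : Module.End K K[X][X]) (sg b) := by
  conv_lhs => rw [← Ph_sg a]
  rw [Ph, eval₂_eq_sum_range' _ h, Finset.sum_mul, map_sum]
  refine Finset.sum_congr rfl fun i _ => ?_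
  rw [mul_assoc, AlgHom.toRingHom_eq_coe, RingHom.coe_coe, sg_aeval_mul, sg_mul, map_pow, rho_x]

lemma sg_mul_natDegree (a b : Weyl K) (m n : ℕ) (ha : (sg a).natDegree ≤ m) (hb : (sg b).natDegree ≤ n) :
    (sg (a * b)).natDegree ≤ m + n := by
  rw [sg_mul_sum a b (m+1) (by omega)]
  apply natDegree_sum_le_of_forall_le
  intro i hi
  have := T_natDegree _ n hb i
  rw [Finset.mem_range] at hi
  exact (natDegree_C_mul_le _ _).trans (by omega)

lemma sg_mul_top (a b : Weyl K) (m n : ℕ) (ha : (sg a).natDegree ≤ m) (hb : (sg b).natDegree ≤ n) :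
    (sg (a * b)).coeff (m + n) = (sg a).coeff m * (sg b).coeff n := by
  rw [sg_mul_sum a b (m+1) (by omega), Finset.sum_range_succ, coeff_add, finsetSum_coeff,
    Finset.sum_eq_zero, zero_add, coeff_C_mul, add_comm m n, T_top _ _ hb]
  intro i hi
  have := T_natDegree _ n hb i
  rw [Finset.mem_range] at hi
  rw [coeff_C_mul, coeff_eq_zero_of_natDegree_lt (n := m + n) (by omega), mul_zero]

lemma sg_mul_sub (a b : Weyl K) (m n : ℕ) (ha : (sg a).natDegree ≤ m + 1) (hb : (sg b).natDegree ≤ n + 1) :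
    (sg (a * b)).coeff (m + n + 1) = (sg a).coeff (m + 1) * (sg b).coeff n + (sg a).coeff m * (sg b).coeff (n + 1)
      + (m + 1) * ((sg a).coeff (m + 1) * derivative ((sg b).coeff (n + 1))) := by
  rw [sg_mul_sum a b (m+1+1) (by omega), Finset.sum_range_succ, Finset.sum_range_succ, coeff_add, coeff_add, finsetSum_coeff,
    Finset.sum_eq_zero, zero_add, coeff_C_mul, coeff_C_mul]
  · have h1 := T_sub _ _ hb (m + 1)
    have h2 := T_top _ _ hb m
    rw [show n + (m + 1) = m + n + 1 by ring] at h1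
    rw [show n + 1 + m = m + n + 1 by ring] at h2
    rw [h1, h2]
    push_cast; ring
  intro i hi
  have := T_natDegree _ _ hb i
  rw [Finset.mem_range] at hi
  rw [coeff_C_mul, coeff_eq_zero_of_natDegree_lt (n := m + n + 1) (by omega), mul_zero]

lemma right_inv (a b : Weyl K) (h : a * b = 1) : ∃ f g : K[X], a = aeval (wT K) f ∧ b = aeval (wT K) g ∧ f * g = 1 := by
  have ha : a ≠ 0 := by
    rintro rfl
    have := congrArg sg h
    simp [sg_one] at this
  have hb : b ≠ 0 := by
    rintro rfl
    have := congrArg sg h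
    simp [sg_one] at this
  have ha' : sg a ≠ 0 := fun h => ha (sg_inj (by simpa using h))
  have hb' : sg b ≠ 0 := fun h => hb (sg_inj (by simpa using h))
  have := sg_mul_top a b _ _ le_rfl le_rfl
  rw [h, sg_one, coeff_one] at this
  have h0 : (sg a).natDegree + (sg b).natDegree = 0 := by
    by_contra hne
    rw [if_neg hne] at this
    simp [ha', hb'] at this
  have h1 : (sg a).natDegree = 0 := by omega
  have h2 : (sg b).natDegree = 0 := by omega
  rw [if_pos h0, h1, h2] at this
  refine ⟨_, _, sg_inj ?_, sg_inj ?_, this.symm⟩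
  · rw [sg_aeval]; exact eq_C_of_natDegree_eq_zero h1
  · rw [sg_aeval]; exact eq_C_of_natDegree_eq_zero h2

lemma const_of_coprime [CharZero K] (B D : K[X]) (h : IsCoprime B D) (h' : D * derivative B = B * derivative D) :
    (∃ b, B = C b) ∧ ∃ d, D = C d := by
  have key : ∀ B D : K[X], IsCoprime B D → D * derivative B = B * derivative D → ∃ b, B = C b := by
    intro B D h h'
    have h1 : B ∣ derivative B := h.dvd_of_dvd_mul_left ⟨_, h'⟩
    have h2 : derivative B = 0 := by
      by_contra hne
      have hB : B.natDegree ≠ 0 := by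
        intro h0
        exact hne (derivative_of_natDegree_zero h0)
      exact absurd (natDegree_le_of_dvd h1 hne) (not_le.2 (natDegree_derivative_lt hB))
    exact ⟨_, eq_C_of_derivative_eq_zero h2⟩
  exact ⟨key B D h h', key D B h.symm h'.symm⟩

lemma inj [CharZero K] (α : Weyl K →ₐ[K] Weyl K) : Function.Injective α := by
  have hnt : Nontrivial (Weyl K) := by
    refine ⟨0, 1, fun h => ?_⟩
    have := congrArg sg h
    simp [sg_one] at this
  rw [injective_iff_map_eq_zero]
  have h0 : ∀ n : ℕ, ∀ f : K[X], f.natDegree ≤ n → α (aeval (wT K) f) = 0 → f = 0 := by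
    intro n
    induction n with
    | zero =>
      intro f hf h
      rw [eq_C_of_natDegree_le_zero hf] at h ⊢
      rw [aeval_C, AlgHom.commutes] at h
      rw [(map_eq_zero_iff _ (algebraMap K (Weyl K)).injective).1 h, C_0]
    | succ n ih =>
      intro f hf h
      have h1 : derivative f = 0 := by
        apply ih
        · exact (natDegree_derivative_le f).trans (by omega)
        · have := congrArg α (x_aeval f)
          rw [map_mul, map_add, map_mul, h] at this
          simpa using this.symm
      apply ih _ _ h
      rw [derivative_eq_zero.1 h1]; omega
  have h2 : ∀ n : ℕ, ∀ a : Weyl K, (sg a).natDegree ≤ n → α a = 0 → a = 0 := by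
    intro n
    induction n with
    | zero =>
      intro a ha h
      have h3 := eq_C_of_natDegree_le_zero ha
      have h4 : a = aeval (wT K) ((sg a).coeff 0) := sg_inj (by rw [sg_aeval]; exact h3)
      rw [h4] at h
      rw [h4, h0 _ _ le_rfl h, map_zero]
    | succ n ih =>
      intro a ha h
      have e : sg (a * wT K - wT K * a) = derivative (sg a) := by
        rw [map_sub, sg_mul_t, sg_t_mul]; ring
      have h1 : a * wT K - wT K * a = 0 := by
        apply ih
        · rw [e]; exact (natDegree_derivative_le _).trans (by omega)
        · simp [h]
      rw [h1, map_zero] at e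
      apply ih _ _ h
      rw [derivative_eq_zero.1 e.symm]; omega
  exact fun a ha => h2 _ a le_rfl ha

lemma surj (α : Weyl K →ₐ[K] Weyl K) (ht : wT K ∈ α.range) (hx : wX K ∈ α.range) : Function.Surjective α := by
  intro a
  rw [← AlgHom.mem_range]
  induction a using weyl_induction with
  | hc c => exact algebraMap_mem _ c
  | ht => exact ht
  | hx => exact hx
  | ha a b h1 h2 => exact add_mem h1 h2
  | hm a b h1 h2 => exact mul_mem h1 h2

end WeylAux

namespace WeylAux
open Polynomial

variable {K : Type*} [Field K]

lemma Ph_mem (S : Subalgebra K (Weyl K)) (hx : wX K ∈ S) (f : K[X][X])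
    (h : ∀ i, ∃ c : K, f.coeff i = C c) : Ph f ∈ S := by
  rw [Ph, eval₂_eq_sum_range]
  refine sum_mem fun i _ => mul_mem ?_ (pow_mem hx i)
  obtain ⟨c, hc⟩ := h i
  rw [hc]
  simp

lemma t_mem [CharZero K] (S : Subalgebra K (Weyl K)) (hx : wX K ∈ S) (z U : Weyl K) (β e : K) (hz : z ∈ S)
    (h : z = aeval (wT K) (C β) * wT K + U * wX K)
    (hc : wX K * z - z * wX K = algebraMap K _ e) : β • wT K ∈ S := by
  have h1 : dt (sg z) = C (C e) := by
    have := congrArg sg hc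
    rw [map_sub, sg_x_mul, sg_mul_x, ← aeval_C (wT K), sg_aeval] at this
    rw [← this]; ring
  have hs : sg z = C (C β * X) + sg U * X := by
    rw [h, map_add, sg_mul_x, sg_aeval_mul, ← aeval_X (R := K) (wT K), sg_aeval, C_mul]
  have h2 : U * wX K ∈ S := by
    rw [← Ph_sg (U * wX K), sg_mul_x]
    apply Ph_mem S hx
    intro i
    rcases i with _ | i
    · exact ⟨0, by simp⟩
    · have h3 := congrArg (fun f => coeff f (i + 1)) h1
      simp only [dt_coeff, hs, coeff_add, coeff_C_succ, zero_add] at h3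
      exact ⟨_, eq_C_of_derivative_eq_zero h3⟩
  have h3 : β • wT K = z - U * wX K := by
    rw [h, aeval_C, Algebra.smul_def]; abel
  rw [h3]
  exact sub_mem hz h2

lemma case_const [CharZero K] (S : Subalgebra K (Weyl K)) (p q U V : Weyl K) (β δ c : K) (hc : c ≠ 0)
    (h1 : q * p = p * q + 1) (hpS : p ∈ S) (hqS : q ∈ S)
    (hne : β ≠ 0 ∨ δ ≠ 0)
    (hp : p = aeval (wT K) (C β) * wT K + U * wX K)
    (hq : q = aeval (wT K) (C δ) * wT K + V * wX K)
    (hV : aeval (wT K) (C β) * V - aeval (wT K) (C δ) * U = aeval (wT K) (C c)) :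
    wT K ∈ S ∧ wX K ∈ S := by
  have hx0 : wX K = c⁻¹ • (β • q - δ • p) := by
    have : β • q - δ • p = c • wX K := by
      have e : (aeval (wT K) (C β) * V - aeval (wT K) (C δ) * U) * wX K = c • wX K := by
        rw [hV, aeval_C, Algebra.smul_def]
      rw [← e, hp, hq]
      simp only [aeval_C, Algebra.algebraMap_eq_smul_one, smul_mul_assoc, one_mul, sub_mul, smul_add, smul_smul, mul_comm δ β]
      abel
    rw [this, smul_smul, inv_mul_cancel₀ hc, one_smul]
  have hx : wX K ∈ S := by
    rw [hx0]
    exact S.smul_mem (sub_mem (S.smul_mem hqS _) (S.smul_mem hpS _)) _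
  have hcp : wX K * p - p * wX K = algebraMap K _ (c⁻¹ * β) := by
    rw [hx0]
    simp only [smul_mul_assoc, mul_smul_comm, sub_mul, mul_sub, h1, smul_add, smul_sub, Algebra.algebraMap_eq_smul_one, mul_smul]
    abel
  have hcq : wX K * q - q * wX K = algebraMap K _ (c⁻¹ * δ) := by
    rw [hx0]
    simp only [smul_mul_assoc, mul_smul_comm, sub_mul, mul_sub, h1, smul_add, smul_sub, Algebra.algebraMap_eq_smul_one, mul_smul]
    abel
  refine ⟨?_, hx⟩
  rcases hne with h | h
  · have := S.smul_mem (t_mem S hx p U β _ hpS hp hcp) β⁻¹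
    rwa [smul_smul, inv_mul_cancel₀ h, one_smul] at this
  · have := S.smul_mem (t_mem S hx q V δ _ hqS hq hcq) δ⁻¹
    rwa [smul_smul, inv_mul_cancel₀ h, one_smul] at this

lemma case_first [CharZero K] (S : Subalgebra K (Weyl K)) (p q : Weyl K) (B D u v : K[X])
    (h1 : q * p = p * q + 1) (hpS : p ∈ S) (hqS : q ∈ S)
    (hp : p = aeval (wT K) B * wT K + aeval (wT K) u * wX K)
    (hq : q = aeval (wT K) D * wT K + aeval (wT K) v * wX K) :
    wT K ∈ S ∧ wX K ∈ S := by
  have hs : ∀ (z : Weyl K) (B u : K[X]), z = aeval (wT K) B * wT K + aeval (wT K) u * wX K →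
      sg z = C (B * X) + C u * X := by
    intro z B u h
    rw [h, map_add, sg_mul_x, sg_aeval_mul, sg_aeval, ← aeval_X (R := K) (wT K), sg_aeval, C_mul]
  have hsp := hs p B u hp
  have hsq := hs q D v hq
  have hd : ∀ B u : K[X], (C (B * X) + C u * X : K[X][X]).natDegree ≤ 1 := by
    intro B u
    rw [add_comm]
    exact natDegree_linear_le
  have hdp : (sg p).natDegree ≤ 1 := hsp ▸ hd _ _
  have hdq : (sg q).natDegree ≤ 1 := hsq ▸ hd _ _
  have hp0 : (sg p).coeff 0 = B * X := by simp [hsp]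
  have hp1 : (sg p).coeff 1 = u := by simp [hsp, coeff_C]
  have hq0 : (sg q).coeff 0 = D * X := by simp [hsq]
  have hq1 : (sg q).coeff 1 = v := by simp [hsq, coeff_C]
  have e1 : v * derivative u = u * derivative v := by
    have := congrArg (fun z => (sg z).coeff 1) h1
    have a1 := sg_mul_sub q p 0 0 hdq hdp
    have a2 := sg_mul_sub p q 0 0 hdp hdq
    simp only [zero_add, Nat.cast_zero, hp0, hp1, hq0, hq1] at a1 a2
    simp only [map_add, coeff_add, a1, a2, sg_one, coeff_one] at this
    simp at this
    linear_combination this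
  have e0 : v * derivative (B * X) - u * derivative (D * X) = 1 := by
    have := congrArg (fun z => (sg z).coeff 0) h1
    simp only [map_add, coeff_add, sg_one] at this
    rw [sg_mul_sum q p 2 (by omega), sg_mul_sum p q 2 (by omega)] at this
    simp only [Finset.sum_range_succ, Finset.sum_range_zero, zero_add, coeff_add, coeff_C_mul, pow_zero, pow_one,
      Module.End.one_apply, T_coeff_zero, hp0, hp1, hq0, hq1, coeff_one_zero] at this
    linear_combination this
  have hcop : IsCoprime u v := ⟨-derivative (D * X), derivative (B * X), by linear_combination e0⟩
  obtain ⟨⟨u0, rfl⟩, ⟨v0, rfl⟩⟩ := const_of_coprime u v hcop e1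
  obtain ⟨e, he⟩ : ∃ e, C v0 * (B * X) - C u0 * (D * X) - X = C e := by
    refine ⟨_, eq_C_of_derivative_eq_zero ?_⟩
    simp only [derivative_sub, derivative_C_mul, derivative_X]
    linear_combination e0
  have ht : wT K ∈ S := by
    have : wT K = v0 • p - u0 • q - algebraMap K _ e := by
      have := congrArg (aeval (wT K)) he
      rw [aeval_C] at this
      rw [← this, hp, hq]
      simp only [map_sub, map_mul, aeval_X, aeval_C, Algebra.algebraMap_eq_smul_one, smul_mul_assoc, one_mul, smul_add, smul_smul, mul_comm u0 v0]
      abel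
    rw [this]
    exact sub_mem (sub_mem (S.smul_mem hpS _) (S.smul_mem hqS _)) (algebraMap_mem _ _)
  refine ⟨ht, ?_⟩
  have hf : ∀ f : K[X], aeval (wT K) f ∈ S := by
    intro f
    exact Algebra.adjoin_le (S := S) (s := {wT K}) (by simpa using ht) (aeval_mem_adjoin_singleton K (wT K) (p := f))
  have hux : u0 • wX K ∈ S := by
    have : u0 • wX K = p - aeval (wT K) B * wT K := by
      rw [hp, aeval_C, Algebra.smul_def]; abel
    rw [this]
    exact sub_mem hpS (mul_mem (hf _) ht)
  have hvx : v0 • wX K ∈ S := by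
    have : v0 • wX K = q - aeval (wT K) D * wT K := by
      rw [hq, aeval_C, Algebra.smul_def]; abel
    rw [this]
    exact sub_mem hqS (mul_mem (hf _) ht)
  by_cases h : u0 = 0
  · have h' : v0 ≠ 0 := by
      rintro rfl
      subst h
      simp at e0
    have := S.smul_mem hvx v0⁻¹
    rwa [smul_smul, inv_mul_cancel₀ h', one_smul] at this
  · have := S.smul_mem hux u0⁻¹
    rwa [smul_smul, inv_mul_cancel₀ h, one_smul] at this

lemma mat_aux {A : Type*} [Ring A] (B D U V a b n11 n12 n21 n22 : A) (hBD : B * D = D * B)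
    (g2 : B * n11 + U * n21 = 1) (g3 : B * n12 + U * n22 = 0)
    (g4 : D * n11 + V * n21 = 0) (g5 : D * n12 + V * n22 = 1) (h : B * a + D * b = 1) :
    (B * V - D * U) * (n22 * a - n21 * b) = 1 := by
  have k1 : (B * V - D * U) * n21 = -D := by
    have : (B * V - D * U) * n21 = B * (D * n11 + V * n21) - D * (B * n11 + U * n21) := by
      rw [mul_add, mul_add, ← mul_assoc, ← mul_assoc, ← mul_assoc, ← mul_assoc, hBD]
      noncomm_ring
    rw [this, g4, g2]; simp
  have k2 : (B * V - D * U) * n22 = B := by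
    have : (B * V - D * U) * n22 = B * (D * n12 + V * n22) - D * (B * n12 + U * n22) := by
      rw [mul_add, mul_add, ← mul_assoc, ← mul_assoc, ← mul_assoc, ← mul_assoc, hBD]
      noncomm_ring
    rw [this, g5, g3]; simp
  rw [mul_sub, ← mul_assoc, ← mul_assoc, k1, k2, neg_mul, sub_neg_eq_add, h]

lemma gens_mem [CharZero K] (S : Subalgebra K (Weyl K)) (p q : Weyl K)
    (h1 : q * p = p * q + 1)
    (B D : Polynomial K) (U V : Weyl K) (hpS : p ∈ S) (hqS : q ∈ S)
    (hp : p = Polynomial.aeval (wT K) B * wT K + U * wX K)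
    (hq : q = Polynomial.aeval (wT K) D * wT K + V * wX K)
    (hM : IsUnit (!![Polynomial.aeval (wT K) B, U; Polynomial.aeval (wT K) D, V] :
      Matrix (Fin 2) (Fin 2) (Weyl K))) : wT K ∈ S ∧ wX K ∈ S := by
  obtain ⟨N, hMN, hNM⟩ := isUnit_iff_exists.1 hM
  have g1 := congrFun (congrFun hNM 0) 0
  have g2 := congrFun (congrFun hMN 0) 0
  have g3 := congrFun (congrFun hMN 0) 1
  have g4 := congrFun (congrFun hMN 1) 0
  have g5 := congrFun (congrFun hMN 1) 1
  simp [Matrix.mul_apply, Fin.sum_univ_two] at g1 g2 g3 g4 g5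
  have hcop : IsCoprime B D := by
    classical
    rw [← EuclideanDomain.gcd_isUnit_iff]
    obtain ⟨B', hB'⟩ := EuclideanDomain.gcd_dvd_left B D
    obtain ⟨D', hD'⟩ := EuclideanDomain.gcd_dvd_right B D
    generalize EuclideanDomain.gcd B D = g at hB' hD'
    have : (N 0 0 * aeval (wT K) B' + N 0 1 * aeval (wT K) D') * aeval (wT K) g = 1 := by
      rw [← g1, hB', hD', mul_comm g, mul_comm g, map_mul, map_mul, add_mul, mul_assoc, mul_assoc]
    obtain ⟨f, g', -, hg, hfg⟩ := right_inv _ _ this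
    have : g = g' := by
      have := congrArg sg hg
      rw [sg_aeval, sg_aeval] at this
      exact C_injective this
    rw [this]
    exact IsUnit.of_mul_eq_one f (by rw [mul_comm]; exact hfg)
  obtain ⟨a, b, hab⟩ := id hcop
  have hBD : aeval (wT K) B * aeval (wT K) D = aeval (wT K) D * aeval (wT K) B := by
    rw [← map_mul, ← map_mul, mul_comm]
  set V' := aeval (wT K) B * V - aeval (wT K) D * U with hV'
  have k3 : V' * (N 1 1 * aeval (wT K) a - N 1 0 * aeval (wT K) b) = 1 := by
    refine mat_aux _ _ _ _ _ _ _ _ _ _ hBD g2 g3 g4 g5 ?_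
    rw [← map_mul, ← map_mul, ← map_add, mul_comm B, mul_comm D, hab, map_one]
  obtain ⟨f, g, hf, -, hfg⟩ := right_inv _ _ k3
  obtain ⟨c, hc, rfl⟩ := Polynomial.isUnit_iff.1 (IsUnit.of_mul_eq_one g hfg)
  set W := aeval (wT K) a * U + aeval (wT K) b * V with hW
  have hU : U = aeval (wT K) B * W - aeval (wT K) (b * C c) := by
    rw [map_mul, ← hf, hV', hW, mul_add, mul_sub, ← mul_assoc, ← mul_assoc, ← mul_assoc, ← mul_assoc, ← map_mul, ← map_mul,
      ← map_mul, ← map_mul]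
    have : aeval (wT K) (a * B + b * D) * U = U := by rw [hab]; simp
    rw [map_add, add_mul] at this
    rw [mul_comm B a, mul_comm B b]
    conv_lhs => rw [← this]
    abel
  have hVV : V = aeval (wT K) D * W + aeval (wT K) (a * C c) := by
    rw [map_mul, ← hf, hV', hW, mul_add, mul_sub, ← mul_assoc, ← mul_assoc, ← mul_assoc, ← mul_assoc, ← map_mul, ← map_mul,
      ← map_mul, ← map_mul]
    have : aeval (wT K) (a * B + b * D) * V = V := by rw [hab]; simp
    rw [map_add, add_mul] at this
    rw [mul_comm D a, mul_comm D b]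
    conv_lhs => rw [← this]
    abel
  have hsU : sg U = C B * sg W - C (b * C c) := by
    conv_lhs => rw [hU]
    rw [map_sub, sg_aeval_mul, sg_aeval]
  have hsV : sg V = C D * sg W + C (a * C c) := by
    conv_lhs => rw [hVV]
    rw [map_add, sg_aeval_mul, sg_aeval]
  rcases hn : (sg W).natDegree with _ | k
  · have hw := eq_C_of_natDegree_eq_zero hn
    set w := (sg W).coeff 0
    have hU' : U = aeval (wT K) (B * w - b * C c) := sg_inj (by rw [hsU, hw, sg_aeval]; simp)
    have hV' : V = aeval (wT K) (D * w + a * C c) := sg_inj (by rw [hsV, hw, sg_aeval]; simp)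
    exact case_first S p q B D _ _ h1 hpS hqS (by rw [← hU']; exact hp) (by rw [← hV']; exact hq)
  · have hw0 : (sg W).coeff (k + 1) ≠ 0 := by
      rw [← hn, coeff_natDegree, leadingCoeff_ne_zero]
      rintro h
      simp [h] at hn
    set w := (sg W).coeff (k + 1) with hw
    have hsp : sg p = C (B * X) + (C B * sg W - C (b * C c)) * X := by
      rw [hp, map_add, sg_mul_x, sg_aeval_mul, hsU, ← aeval_X (R := K) (wT K), sg_aeval, C_mul (a := B)]
    have hsq : sg q = C (D * X) + (C D * sg W + C (a * C c)) * X := by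
      rw [hq, map_add, sg_mul_x, sg_aeval_mul, hsV, ← aeval_X (R := K) (wT K), sg_aeval, C_mul (a := D)]
    have hp1 : (sg p).coeff (k + 1 + 1) = B * w := by
      rw [hsp, coeff_add, coeff_mul_X, coeff_sub, coeff_C_succ, coeff_C_succ, coeff_C_mul]; ring
    have hq1 : (sg q).coeff (k + 1 + 1) = D * w := by
      rw [hsq, coeff_add, coeff_mul_X, coeff_add, coeff_C_succ, coeff_C_succ, coeff_C_mul]; ring
    have hdp : (sg p).natDegree ≤ k + 1 + 1 := by
      rw [natDegree_le_iff_coeff_eq_zero]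
      intro j hj
      obtain ⟨j, rfl⟩ : ∃ i, j = i + 1 + 1 := ⟨j - 2, by omega⟩
      rw [hsp, coeff_add, coeff_mul_X, coeff_sub, coeff_C_succ, coeff_C_succ, coeff_C_mul,
        coeff_eq_zero_of_natDegree_lt (n := j + 1) (by omega)]; ring
    have hdq : (sg q).natDegree ≤ k + 1 + 1 := by
      rw [natDegree_le_iff_coeff_eq_zero]
      intro j hj
      obtain ⟨j, rfl⟩ : ∃ i, j = i + 1 + 1 := ⟨j - 2, by omega⟩
      rw [hsq, coeff_add, coeff_mul_X, coeff_add, coeff_C_succ, coeff_C_succ, coeff_C_mul,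
        coeff_eq_zero_of_natDegree_lt (n := j + 1) (by omega)]; ring
    have e1 : D * derivative B = B * derivative D := by
      have := congrArg (fun z => (sg z).coeff (k + 1 + (k + 1) + 1)) h1
      simp only [map_add, coeff_add, sg_one] at this
      rw [sg_mul_sub q p _ _ hdq hdp, sg_mul_sub p q _ _ hdp hdq, hp1, hq1, coeff_one, if_neg (by omega)] at this
      have hk : ((k + 1 : ℕ) + 1 : K[X]) ≠ 0 := by exact_mod_cast Nat.succ_ne_zero (k + 1)
      have h3 : (((k + 1 : ℕ) : K[X]) + 1) * (w * w) * (D * derivative B - B * derivative D) = 0 := by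
        simp only [derivative_mul] at this
        linear_combination this
      have := (mul_eq_zero.1 h3).resolve_left (mul_ne_zero hk (mul_ne_zero hw0 hw0))
      linear_combination this
    obtain ⟨⟨β, hβ⟩, ⟨δ, hδ⟩⟩ := const_of_coprime B D hcop e1
    rw [hβ] at hp
    rw [hδ] at hq
    rw [hβ, hδ] at hV'
    refine case_const S p q U V β δ c hc.ne_zero h1 hpS hqS ?_ hp hq (hV'.symm.trans hf)
    by_contra! hcon
    rw [hβ, hδ, hcon.1, hcon.2] at hab
    simp at hab

end WeylAux

/-- Let `p, q ∈ A₁(K)` with `q·p = p·q + 1`, and suppose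
`p = B(t)·t + U·x` and `q = D(t)·t + V·x` with the matrix `[[B(t), U], [D(t), V]]`
invertible in `M₂(A₁(K))`.  Then there is a `K`-algebra endomorphism `α` of `A₁(K)`
with `α(t) = p`, `α(x) = q`, and every such endomorphism is bijective. -/
theorem weyl_matrix_criterion (K : Type*) [Field K] [CharZero K] (p q : Weyl K)
    (h1 : q * p = p * q + 1)
    (B D : Polynomial K) (U V : Weyl K)
    (hp : p = Polynomial.aeval (wT K) B * wT K + U * wX K)
    (hq : q = Polynomial.aeval (wT K) D * wT K + V * wX K)
    (hM : IsUnit (!![Polynomial.aeval (wT K) B, U; Polynomial.aeval (wT K) D, V] :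
      Matrix (Fin 2) (Fin 2) (Weyl K))) :
    (∃ α : Weyl K →ₐ[K] Weyl K, α (wT K) = p ∧ α (wX K) = q) ∧
    (∀ α : Weyl K →ₐ[K] Weyl K, α (wT K) = p → α (wX K) = q →
      Function.Bijective α) := by
  refine ⟨WeylAux.exists_lift p q h1, fun α hα1 hα2 => ⟨WeylAux.inj α, ?_⟩⟩
  obtain ⟨ht, hx⟩ := WeylAux.gens_mem α.range p q h1 B D U V ⟨_, hα1⟩ ⟨_, hα2⟩ hp hq hM
  exact WeylAux.surj α ht hx
end

section
/- Let λ ∈ K \ {0}, α ∈ K, and f, g ∈ K[X]. Then each of the following pairs (p, q) of elements of A_1(K) satisfies q·p = p·q + 1: (Type I) p = α·t + λ^{-1}·(α·f(x) − 1)·x and q = λ·t + f(x)·x; (Type II) p = −f(t)·t − λ·x and q = λ^{-1}·(α·f(t) + 1)·t + α·x; (Type III) p = λ·t + g(x)·x and q = λ^{-1}·x; (Type IV) p = λ^{-1}·t and q = g(t)·t + λ·x. -/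
theorem weyl_aux {K A : Type*} [Field K] [Ring A] [Algebra K A] (l al : K) (hl : l ≠ 0)
    (t x : A) (h : x * t = t * x + 1) (f g : Polynomial K) :
    ((l • t + Polynomial.aeval x f * x) *
        (al • t + l⁻¹ • ((al • Polynomial.aeval x f - 1) * x)) =
      (al • t + l⁻¹ • ((al • Polynomial.aeval x f - 1) * x)) *
        (l • t + Polynomial.aeval x f * x) + 1) ∧
    ((l⁻¹ • ((al • Polynomial.aeval t f + 1) * t) + al • x) *
        (-(Polynomial.aeval t f * t) - l • x) =
      (-(Polynomial.aeval t f * t) - l • x) *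
        (l⁻¹ • ((al • Polynomial.aeval t f + 1) * t) + al • x) + 1) ∧
    ((l⁻¹ • x) * (l • t + Polynomial.aeval x g * x) =
      (l • t + Polynomial.aeval x g * x) * (l⁻¹ • x) + 1) ∧
    ((Polynomial.aeval t g * t + l • x) * (l⁻¹ • t) =
      (l⁻¹ • t) * (Polynomial.aeval t g * t + l • x) + 1) := by
  have comm : ∀ (y : A) (p : Polynomial K),
      y * (Polynomial.aeval y p * y) = (Polynomial.aeval y p * y) * y := by
    intro y p
    have : Polynomial.aeval y (Polynomial.X * (p * Polynomial.X)) =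
        Polynomial.aeval y ((p * Polynomial.X) * Polynomial.X) := by
      congr 1; ring
    simpa only [map_mul, Polynomial.aeval_X] using this
  have h3 : ∀ p : Polynomial K, x * (l • t + Polynomial.aeval x p * x) =
      (l • t + Polynomial.aeval x p * x) * x + l • (1 : A) := by
    intro p
    rw [mul_add, add_mul, comm, mul_smul_comm, smul_mul_assoc, h, smul_add]
    abel
  have h4 : ∀ p : Polynomial K, (Polynomial.aeval t p * t + l • x) * t =
      t * (Polynomial.aeval t p * t + l • x) + l • (1 : A) := by
    intro p
    rw [mul_add, add_mul, comm, mul_smul_comm, smul_mul_assoc, h, smul_add]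
    abel
  refine ⟨?_, ?_, ?_, ?_⟩
  · have e : al • t + l⁻¹ • ((al • Polynomial.aeval x f - 1) * x) =
        l⁻¹ • (al • (l • t + Polynomial.aeval x f * x) - x) := by
      rw [sub_mul, smul_mul_assoc, one_mul, smul_add, smul_sub, smul_sub, smul_add,
        smul_comm al l t, inv_smul_smul₀ hl]
      abel
    have := h3 f
    rw [e]
    generalize l • t + Polynomial.aeval x f * x = q at this ⊢
    rw [mul_smul_comm, smul_mul_assoc, mul_sub, sub_mul, this, mul_smul_comm, smul_mul_assoc,
      ← inv_smul_smul₀ hl (1 : A), ← smul_add, inv_smul_smul₀ hl]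
    congr 1
    abel
  · have e : l⁻¹ • ((al • Polynomial.aeval t f + 1) * t) + al • x =
        l⁻¹ • (al • (Polynomial.aeval t f * t + l • x) + t) := by
      rw [add_mul, smul_mul_assoc, one_mul, smul_add, smul_add, smul_add, smul_add,
        smul_comm al l x, inv_smul_smul₀ hl]
      abel
    have e2 : -(Polynomial.aeval t f * t) - l • x = -(Polynomial.aeval t f * t + l • x) := by
      abel
    have := h4 f
    rw [e, e2]
    generalize Polynomial.aeval t f * t + l • x = q at this ⊢
    rw [mul_neg, neg_mul, mul_smul_comm, smul_mul_assoc, mul_add, add_mul, this, mul_smul_comm,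
      smul_mul_assoc, ← inv_smul_smul₀ hl (1 : A), ← smul_neg, ← smul_neg, ← smul_add,
      inv_smul_smul₀ hl]
    congr 1
    abel
  · rw [smul_mul_assoc, mul_smul_comm, h3, smul_add, inv_smul_smul₀ hl]
  · rw [smul_mul_assoc, mul_smul_comm, h4, smul_add, inv_smul_smul₀ hl]

theorem weyl_rel_aux (K : Type*) [Field K] : wX K * wT K = wT K * wX K + 1 := by
  have := RingQuot.mkAlgHom_rel K (s := weylRel K) ⟨rfl, rfl⟩
  rw [map_mul, map_add, map_mul, map_one] at this
  unfold wX wT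
  exact this

/-- For `λ ∈ K \ {0}`, `α ∈ K` and `f, g ∈ K[X]`, each of the four
pairs (Type I–IV) of elements of `A₁(K)` satisfies `q·p = p·q + 1`. -/
theorem weyl_dixmier_pairs_types (K : Type*) [Field K] [CharZero K]
    (l al : K) (hl : l ≠ 0) (f g : Polynomial K) :
    -- Type I:  p = α·t + λ⁻¹·(α·f(x) − 1)·x,  q = λ·t + f(x)·x
    ((l • wT K + Polynomial.aeval (wX K) f * wX K) *
        (al • wT K + l⁻¹ • ((al • Polynomial.aeval (wX K) f - 1) * wX K)) =
      (al • wT K + l⁻¹ • ((al • Polynomial.aeval (wX K) f - 1) * wX K)) *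
        (l • wT K + Polynomial.aeval (wX K) f * wX K) + 1) ∧
    -- Type II:  p = −f(t)·t − λ·x,  q = λ⁻¹·(α·f(t) + 1)·t + α·x
    ((l⁻¹ • ((al • Polynomial.aeval (wT K) f + 1) * wT K) + al • wX K) *
        (-(Polynomial.aeval (wT K) f * wT K) - l • wX K) =
      (-(Polynomial.aeval (wT K) f * wT K) - l • wX K) *
        (l⁻¹ • ((al • Polynomial.aeval (wT K) f + 1) * wT K) + al • wX K) + 1) ∧
    -- Type III:  p = λ·t + g(x)·x,  q = λ⁻¹·x
    ((l⁻¹ • wX K) * (l • wT K + Polynomial.aeval (wX K) g * wX K) =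
      (l • wT K + Polynomial.aeval (wX K) g * wX K) * (l⁻¹ • wX K) + 1) ∧
    -- Type IV:  p = λ⁻¹·t,  q = g(t)·t + λ·x
    ((Polynomial.aeval (wT K) g * wT K + l • wX K) * (l⁻¹ • wT K) =
      (l⁻¹ • wT K) * (Polynomial.aeval (wT K) g * wT K + l • wX K) + 1) := by
  exact weyl_aux l al hl (wT K) (wX K) (weyl_rel_aux K) f g
end
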